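/- Let A be a badly approximable n × d matrix with approximation constant C_A, and let Q be the generating measure of the random walk on 𝕋^d generated by the rows of A. Then for every k ≥ 1, D(Q^{*k}) ≤ (3/2)^d · 20 · (n/(C_A√2))^{n/d} · k^{−n/(2d)}. -/

import Mathlib

open MeasureTheory Real

/-- Distance from a real number to the nearest integer. -/
noncomputable def intDist (x : ℝ) : ℝ := |x - round x|

/-- Supremum over coordinates of the distance to the nearest integer point. -/
noncomputable def supIntDist {m : ℕ} (v : Fin m → ℝ) : ℝ := ⨆ i, intDist (v i)

/-- The d-dimensional torus. -/
abbrev Torus (d : ℕ) := Fin d → UnitAddCircle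

noncomputable def toTorus {d : ℕ} (v : Fin d → ℝ) : Torus d := fun i => (v i : UnitAddCircle)

/-- The generating measure of the random walk: mass 1/(2n) at each of ±α_j. -/
noncomputable def genMeasure {n d : ℕ} (α : Fin n → Fin d → ℝ) : Measure (Torus d) :=
  (2 * n : ENNReal)⁻¹ • ∑ j, (Measure.dirac (toTorus (α j)) + Measure.dirac (-(toTorus (α j))))

/-- k-fold convolution power of a measure on the torus. -/
noncomputable def convPow {d : ℕ} (μ : Measure (Torus d)) : ℕ → Measure (Torus d)
  | 0 => Measure.dirac 0
  | k + 1 => (convPow μ k).conv μ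

/-- A circular arc: the image in the circle of `[a, b)`. -/
noncomputable def arcSet (a b : ℝ) : Set UnitAddCircle :=
  (fun x : ℝ => (x : UnitAddCircle)) '' Set.Ico a b

/-- A box in the torus with sides `[a i, b i)`. -/
noncomputable def box {d : ℕ} (a b : Fin d → ℝ) : Set (Torus d) :=
  Set.univ.pi fun i => arcSet (a i) (b i)

/-- Discrepancy of a measure from Haar (volume) measure over boxes. -/
noncomputable def disc {d : ℕ} (P : Measure (Torus d)) : ℝ :=
  ⨆ a : Fin d → ℝ, ⨆ b : Fin d → ℝ,
    |(P (box a b)).toReal - (volume (box a b)).toReal|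


lemma meas_arcSet (a b : ℝ) : MeasurableSet (arcSet a b) := by
  have : arcSet a b = (AddCircle.measurableEquivIco (1:ℝ) a) ⁻¹' {t | (t : ℝ) < b} := by
    ext x
    constructor
    · rintro ⟨r, ⟨h1, h2⟩, rfl⟩
      show ((AddCircle.equivIco 1 a (r : AddCircle (1:ℝ)) : ℝ)) < b
      have h0 : ((AddCircle.equivIco 1 a (r : AddCircle (1:ℝ)) : ℝ)) = toIcoMod (zero_lt_one' ℝ) a r := rfl
      rw [h0]
      refine lt_of_le_of_lt ?_ h2
      have h3 := toIcoMod_add_toIcoDiv_zsmul (zero_lt_one' ℝ) a r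
      have h4 : 0 ≤ toIcoDiv (zero_lt_one' ℝ) a r := by
        by_contra hc
        have h5 := toIcoMod_lt_right (zero_lt_one' ℝ) a r
        have : toIcoDiv (zero_lt_one' ℝ) a r ≤ -1 := by omega
        have h6 : (toIcoDiv (zero_lt_one' ℝ) a r : ℝ) ≤ -1 := by exact_mod_cast this
        simp at h3
        linarith
      have h6 : (0:ℝ) ≤ toIcoDiv (zero_lt_one' ℝ) a r := by exact_mod_cast h4
      simp at h3
      linarith
    · intro hx
      have hx' : ((AddCircle.equivIco 1 a x : ℝ)) < b := hx
      exact ⟨AddCircle.equivIco 1 a x, ⟨(AddCircle.equivIco 1 a x).2.1, hx'⟩,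
        (AddCircle.equivIco 1 a).symm_apply_apply x⟩
  rw [this]
  exact (AddCircle.measurableEquivIco (1:ℝ) a).measurable (measurable_subtype_coe measurableSet_Iio)

lemma meas_box {d : ℕ} (a b : Fin d → ℝ) : MeasurableSet (box a b) :=
  MeasurableSet.univ_pi fun _ => meas_arcSet _ _

instance : IsProbabilityMeasure (volume : Measure UnitAddCircle) := ⟨by simp⟩

lemma vol_arcSet_le (a t : ℝ) (ht : 0 ≤ t) : (volume : Measure UnitAddCircle).real (arcSet a (a+t)) ≤ t := by
  by_cases h1 : 1 ≤ t
  · exact le_trans measureReal_le_one h1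
  push Not at h1
  have hmp := UnitAddCircle.measurePreserving_mk (a + t - 1)
  have h2 : (volume : Measure UnitAddCircle) (arcSet a (a+t)) ≤ ENNReal.ofReal t := by
    rw [← hmp.measure_preimage (meas_arcSet _ _).nullMeasurableSet,
      Measure.restrict_apply (hmp.measurable (meas_arcSet _ _))]
    calc _ ≤ volume (Set.Icc a (a+t)) := by
          apply measure_mono
          rintro x ⟨⟨r, ⟨hr1, hr2⟩, hrx⟩, hx1, hx2⟩
          have : ∃ m : ℤ, x - r = m := by
            have h3 : ((r:ℝ) : AddCircle (1:ℝ)) = x := hrx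
            have h4 : (((x - r : ℝ)) : AddCircle (1:ℝ)) = 0 := by
              rw [AddCircle.coe_sub, h3, sub_self]
            obtain ⟨m, hm⟩ := (AddCircle.coe_eq_zero_iff (1:ℝ)).1 h4
            exact ⟨m, by simpa using hm.symm⟩
          obtain ⟨m, hm⟩ := this
          have h5 : (-1 : ℤ) < m := by
            have : ((-1:ℤ):ℝ) < m := by push_cast; linarith
            exact_mod_cast this
          have h6 : m < 1 := by
            have : (m:ℝ) < ((1:ℤ):ℝ) := by push_cast; linarith
            exact_mod_cast this
          have : m = 0 := by omega
          subst this
          simp at hm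
          constructor <;> linarith
      _ = _ := by simp
  exact ENNReal.toReal_le_of_le_ofReal ht h2

/-- coordinate marginals -/
lemma vol_coord {d : ℕ} (i : Fin d) (S : Set UnitAddCircle) (hS : MeasurableSet S) :
    (volume : Measure (Torus d)).real {x | x i ∈ S} = (volume : Measure UnitAddCircle).real S := by
  have := (measurePreserving_eval (fun _ : Fin d => (volume : Measure UnitAddCircle)) i).measureReal_preimage hS.nullMeasurableSet
  exact this

lemma arc_expand (a b δ : ℝ) :
    arcSet (a - δ) (b + δ) ⊆ arcSet a b ∪ (arcSet (a-δ) (a-δ+δ) ∪ arcSet b (b+δ)) := by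
  rintro _ ⟨r, ⟨h1, h2⟩, rfl⟩
  by_cases h3 : r < a
  · right; left; exact ⟨r, ⟨h1, by linarith⟩, rfl⟩
  by_cases h4 : r < b
  · left; exact ⟨r, ⟨by linarith, h4⟩, rfl⟩
  · right; right; exact ⟨r, ⟨by linarith, h2⟩, rfl⟩

lemma arc_shift (a b t : ℝ) (ht : 0 ≤ t) (x : UnitAddCircle)
    (hx : ¬ (x ∈ arcSet a b ↔ x + (t : ℝ) ∈ arcSet a b)) :
    x ∈ arcSet (a-t) (a-t+t) ∪ arcSet (b-t) (b-t+t) := by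
  by_cases h : x ∈ arcSet a b
  · have h2 : x + (t : ℝ) ∉ arcSet a b := by tauto
    obtain ⟨r, ⟨h3, h4⟩, rfl⟩ := h
    right
    refine ⟨r, ⟨?_, by linarith⟩, rfl⟩
    by_contra h5
    push Not at h5
    exact h2 ⟨r + t, ⟨by linarith, by linarith⟩, by simp⟩
  · have h2 : x + (t : ℝ) ∈ arcSet a b := by tauto
    obtain ⟨r, ⟨h3, h4⟩, hr⟩ := h2
    have hx2 : x = ((r - t : ℝ) : UnitAddCircle) := by
      rw [AddCircle.coe_sub, ← sub_eq_iff_eq_add.mpr hr.symm.symm]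
    left
    refine ⟨r - t, ⟨by linarith, ?_⟩, hx2.symm⟩
    by_contra h5
    push Not at h5
    exact h ⟨r - t, ⟨by linarith, by linarith⟩, hx2.symm⟩

/-- Growing a box by `δ` in every direction adds at most `2dδ` of volume. -/
lemma vol_box_expand {d : ℕ} (a b : Fin d → ℝ) (δ : ℝ) (hδ : 0 ≤ δ) :
    (volume : Measure (Torus d)).real (box (fun i => a i - δ) (fun i => b i + δ)) ≤
      (volume : Measure (Torus d)).real (box a b) + 2 * d * δ := by
  have hsub : box (fun i => a i - δ) (fun i => b i + δ) ⊆ box a b ∪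
      ⋃ i, {x : Torus d | x i ∈ arcSet (a i-δ) (a i-δ+δ) ∪ arcSet (b i) (b i+δ)} := by
    intro x hx
    by_cases h : ∃ i, x i ∉ arcSet (a i) (b i)
    · obtain ⟨i, hi⟩ := h
      right
      rw [Set.mem_iUnion]
      refine ⟨i, ?_⟩
      rcases arc_expand _ _ _ (hx i (Set.mem_univ i)) with h1 | h1
      · exact absurd h1 hi
      · exact h1
    · push Not at h
      left
      exact fun i _ => h i
  calc _ ≤ _ := measureReal_mono hsub
    _ ≤ _ := measureReal_union_le _ _
    _ ≤ _ := by
      gcongr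
      calc _ ≤ ∑ i : Fin d, (volume : Measure (Torus d)).real
            {x : Torus d | x i ∈ arcSet (a i-δ) (a i-δ+δ) ∪ arcSet (b i) (b i+δ)} :=
              measureReal_iUnion_fintype_le _
        _ ≤ ∑ i : Fin d, 2 * δ := by
            gcongr with i
            rw [vol_coord i _ ((meas_arcSet _ _).union (meas_arcSet _ _))]
            refine (measureReal_union_le _ _).trans ?_
            have h1 := vol_arcSet_le (a i - δ) δ hδ
            have h2 := vol_arcSet_le (b i) δ hδ
            linarith
        _ = 2 * d * δ := by simp; ring

/-- a lift of a torus point -/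
lemma torus_lift {d : ℕ} (y : Torus d) : ∃ t : Fin d → ℝ, (∀ i, (t i : UnitAddCircle) = y i) ∧
    ∀ i, |t i| = ‖y i‖ := by
  have : ∀ i, ∃ t : ℝ, (t : UnitAddCircle) = y i ∧ |t| = ‖y i‖ := by
    intro i
    obtain ⟨r, hr⟩ := QuotientAddGroup.mk_surjective (y i)
    refine ⟨r - round r, ?_, ?_⟩
    · rw [← hr, AddCircle.coe_sub]
      have : ((round r : ℝ) : UnitAddCircle) = 0 := by
        rw [AddCircle.coe_eq_zero_iff]; exact ⟨round r, by simp⟩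
      rw [this]; simp
    · rw [← hr]; exact (UnitAddCircle.norm_eq (x := r)).symm
  choose t h1 h2 using this
  exact ⟨t, h1, h2⟩

lemma arc_translate (a b t : ℝ) (x : UnitAddCircle) :
    x + (t : UnitAddCircle) ∈ arcSet a b ↔ x ∈ arcSet (a - t) (b - t) := by
  constructor
  · rintro ⟨r, ⟨h1, h2⟩, hr⟩
    refine ⟨r - t, ⟨by linarith, by linarith⟩, ?_⟩
    have : (r : UnitAddCircle) = x + t := hr
    simp only [AddCircle.coe_sub, this]; simp
  · rintro ⟨r, ⟨h1, h2⟩, rfl⟩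
    exact ⟨r + t, ⟨by linarith, by linarith⟩, by simp⟩

lemma box_translate {d : ℕ} (a b t : Fin d → ℝ) (y : Torus d) (ht : ∀ i, (t i : UnitAddCircle) = y i) :
    {x | x + y ∈ box a b} = box (fun i => a i - t i) (fun i => b i - t i) := by
  ext x
  simp only [box, Set.mem_setOf_eq, Set.mem_pi, Set.mem_univ, true_implies, Pi.add_apply, ← ht,
    arc_translate]

lemma box_mono {d : ℕ} {a b a' b' : Fin d → ℝ} (h1 : ∀ i, a' i ≤ a i) (h2 : ∀ i, b i ≤ b' i) :
    box a b ⊆ box a' b' := by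
  intro x hx i hi
  obtain ⟨r, ⟨h3, h4⟩, h5⟩ := hx i hi
  exact ⟨r, ⟨(h1 i).trans h3, h4.trans_le (h2 i)⟩, h5⟩

/-- single-coordinate shift changes a box by a set of small measure -/
lemma vol_box_shift {d : ℕ} (a b : Fin d → ℝ) (i : Fin d) (t : ℝ) (ht : 0 ≤ t) :
    (volume : Measure (Torus d)).real {x : Torus d | ¬ (x ∈ box a b ↔
      x + Pi.single i (t : UnitAddCircle) ∈ box a b)} ≤ 2 * t := by
  have hsub : {x : Torus d | ¬ (x ∈ box a b ↔ x + Pi.single i (t : UnitAddCircle) ∈ box a b)} ⊆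
      {x | x i ∈ arcSet (a i-t) (a i-t+t) ∪ arcSet (b i-t) (b i-t+t)} := by
    intro x hx
    apply arc_shift _ _ _ ht
    intro hc
    apply hx
    simp only [box, Set.mem_pi, Set.mem_univ, true_implies, Pi.add_apply]
    constructor
    · intro h j
      by_cases hj : j = i
      · subst hj; simpa using hc.1 (h j)
      · simpa [hj] using h j
    · intro h j
      by_cases hj : j = i
      · subst hj; exact hc.2 (by simpa using h j)
      · simpa [hj] using h j
  refine (measureReal_mono hsub).trans ?_
  rw [vol_coord i _ ((meas_arcSet _ _).union (meas_arcSet _ _))]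
  refine (measureReal_union_le _ _).trans ?_
  have h1 := vol_arcSet_le (a i - t) t ht
  have h2 := vol_arcSet_le (b i - t) t ht
  linarith


section four
open UnitAddTorus

lemma mF_add {d : ℕ} (h : Fin d → ℤ) (x y : Torus d) :
    mFourier h (x + y) = mFourier h x * mFourier h y := by
  simp only [mFourier, ContinuousMap.coe_mk, Pi.add_apply, fourier_apply, smul_add,
    AddCircle.toCircle_add, Circle.coe_mul, Finset.prod_mul_distrib]

lemma mF_norm {d : ℕ} (h : Fin d → ℤ) (x : Torus d) : ‖mFourier h x‖ = 1 := by
  simp only [mFourier, fourier_apply, ContinuousMap.coe_mk, norm_prod, Circle.norm_coe,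
      Finset.prod_const_one]

lemma mF_shift {d : ℕ} (h : Fin d → ℤ) (i : Fin d) (hi : h i ≠ 0) (x : Torus d) :
    mFourier h (x + Pi.single i ((1 / (2 * |(h i : ℝ)|) : ℝ) : UnitAddCircle)) = - mFourier h x := by
  rw [mF_add]
  have : mFourier h (Pi.single i ((1 / (2 * |(h i : ℝ)|) : ℝ) : UnitAddCircle) : Torus d) = -1 := by
    simp only [mFourier, ContinuousMap.coe_mk]
    rw [Finset.prod_eq_single i]
    · rw [Pi.single_eq_same, fourier_coe_apply]
      have hi' : (h i : ℝ) ≠ 0 := by exact_mod_cast hi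
      have hi2 : (h i : ℂ) ≠ 0 := by exact_mod_cast hi
      rcases lt_or_gt_of_ne hi' with hl | hl
      · rw [abs_of_neg hl]
        have : (2 * π * Complex.I * (h i) * ((1 / (2 * -(h i : ℝ)) : ℝ) : ℂ) / (1:ℝ) : ℂ) = -(π * Complex.I) := by
          push_cast; field_simp
        rw [this, Complex.exp_neg, Complex.exp_pi_mul_I]; norm_num
      · rw [abs_of_pos hl]
        have : (2 * π * Complex.I * (h i) * ((1 / (2 * (h i : ℝ)) : ℝ) : ℂ) / (1:ℝ) : ℂ) = (π * Complex.I) := by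
          push_cast; field_simp
        rw [this, Complex.exp_pi_mul_I]
    · intro j _ hj
      rw [Pi.single_eq_of_ne hj, fourier_eval_zero]
    · simp
  rw [this]; ring

lemma integral_mF {d : ℕ} (h : Fin d → ℤ) :
    ∫ x : Torus d, mFourier h x = if h = 0 then 1 else 0 := by
  split_ifs with h0
  · subst h0; simp [mFourier_zero]
  · obtain ⟨i, hi⟩ := Function.ne_iff.1 h0
    exact integral_eq_zero_of_add_right_eq_neg (μ := (volume : Measure (Torus d))) (mF_shift h i hi)

lemma integrable_mF {d : ℕ} (μ : Measure (Torus d)) [IsFiniteMeasure μ] (h : Fin d → ℤ) :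
    Integrable (fun x => mFourier h x) μ :=
  Integrable.of_bound (mFourier h).continuous.aestronglyMeasurable 1
    (Filter.Eventually.of_forall fun x => (mF_norm h x).le)

/-- Fourier coefficient of a box -/
noncomputable def boxF {d : ℕ} (a b : Fin d → ℝ) (h : Fin d → ℤ) : ℂ :=
  ∫ y : Torus d, (box a b).indicator (fun y => mFourier h y) y

lemma boxF_zero {d : ℕ} (a b : Fin d → ℝ) :
    boxF a b 0 = ((volume : Measure (Torus d)).real (box a b) : ℂ) := by
  simp only [boxF, mFourier_zero]
  rw [integral_indicator (meas_box a b)]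
  simp [Measure.real]

lemma boxF_le {d : ℕ} (a b : Fin d → ℝ) (h : Fin d → ℤ) (i : Fin d) (hi : h i ≠ 0) :
    ‖boxF a b h‖ ≤ 1 / (2 * |(h i : ℝ)|) := by
  set t : ℝ := 1 / (2 * |(h i : ℝ)|) with ht
  have ht0 : 0 ≤ t := by positivity
  set T : Torus d := Pi.single i (t : UnitAddCircle)
  set F : Torus d → ℂ := (box a b).indicator (fun y => mFourier h y) with hF
  have hFi : Integrable F := (integrable_mF _ h).indicator (meas_box a b)
  have h1 : boxF a b h = ∫ y, F (y + T) := (integral_add_right_eq_self F T).symm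
  have h2 : 2 * boxF a b h = ∫ y, (F y + F (y + T)) := by
    rw [integral_add hFi (hFi.comp_add_right T), ← h1, two_mul]; rfl
  set S : Set (Torus d) := {x : Torus d | ¬ (x ∈ box a b ↔ x + T ∈ box a b)}
  have hS : MeasurableSet S := by
    have h3 : MeasurableSet {x : Torus d | x ∈ box a b} := meas_box a b
    have h4 : MeasurableSet {x : Torus d | x + T ∈ box a b} :=
      (measurable_add_const T) (meas_box a b)
    exact (h3.iff h4).compl
  have h5 : ‖∫ y, (F y + F (y + T))‖ ≤ ∫ y, S.indicator (fun _ => (1:ℝ)) y := by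
    apply norm_integral_le_of_norm_le
    · exact (integrable_const _).indicator hS
    · refine Filter.Eventually.of_forall fun y => ?_
      have hsh := mF_shift h i hi y
      by_cases hy1 : y ∈ box a b <;> by_cases hy2 : y + T ∈ box a b <;>
        simp [hF, S, hy1, hy2, mF_norm]
      rw [hsh]; simp
  have h6 : ∫ y, S.indicator (fun _ => (1:ℝ)) y ≤ 2 * t := by
    rw [integral_indicator hS]
    simp only [integral_const, smul_eq_mul, mul_one, measureReal_restrict_apply_univ]
    exact vol_box_shift a b i t ht0
  rw [← h2, norm_mul] at h5
  simp at h5 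
  linarith

end four


lemma sum_sin_aux (θ : ℝ) (N : ℕ) :
    2 * cos θ * ∑ m ∈ Finset.range N, sin ((m + 1 : ℕ) * θ) ^ 2 =
      2 * ∑ m ∈ Finset.range N, sin (m * θ) * sin ((m + 1 : ℕ) * θ) +
        sin (N * θ) * sin ((N + 1 : ℕ) * θ) := by
  induction N with
  | zero => simp
  | succ N ih =>
    rw [Finset.sum_range_succ, Finset.sum_range_succ, mul_add, ih]
    have e1 : sin ((N + 1 + 1 : ℕ) * θ) = sin ((N+1 : ℕ) * θ) * cos θ + cos ((N+1 : ℕ) * θ) * sin θ := by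
      rw [← sin_add]; congr 1; push_cast; ring
    have e2 : sin (N * θ) = sin ((N+1 : ℕ) * θ) * cos θ - cos ((N+1 : ℕ) * θ) * sin θ := by
      rw [← sin_sub]; congr 1; push_cast; ring
    rw [e1, e2]; ring

lemma kernel1 (H : ℕ) (hH : 2 ≤ H) : ∃ (c : ℤ → ℝ) (K : UnitAddCircle → ℝ), Continuous K ∧
    (∀ z, 0 ≤ K z) ∧ (∀ z, (K z : ℂ) = ∑ j ∈ Finset.Ioo (-(H:ℤ)) H, (c j : ℂ) * fourier j z) ∧
    c 0 = 1 ∧ c (-1) = cos (π / (H + 1)) := by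
  set θ : ℝ := π / (H + 1) with hθ
  set a : ℕ → ℝ := fun m => sin ((m + 1 : ℕ) * θ) with ha
  set S : ℝ := ∑ m ∈ Finset.range H, a m ^ 2 with hS
  have hSpos : 0 < S := by
    apply Finset.sum_pos'
    · intro i _; positivity
    · refine ⟨0, by simp; omega, ?_⟩
      have : 0 < sin θ := by
        apply sin_pos_of_pos_of_lt_pi
        · positivity
        · rw [hθ, div_lt_iff₀ (by positivity)]
          have : (2:ℝ) ≤ H := by exact_mod_cast hH
          nlinarith [pi_pos]
      simp only [ha]; simp; positivity
  set p : UnitAddCircle → ℂ := fun z => ∑ m ∈ Finset.range H, (a m : ℂ) * fourier (m : ℤ) z with hp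
  set R := Finset.range H ×ˢ Finset.range H with hR
  refine ⟨fun j => (∑ q ∈ R with ((q.1 : ℤ) - q.2 = j), a q.1 * a q.2) / S,
    fun z => ‖p z‖ ^ 2 / S, ?_, ?_, ?_, ?_, ?_⟩
  · simp only [hp]; fun_prop
  · intro z; positivity
  · intro z
    have h1 : ((‖p z‖ ^ 2 : ℝ) : ℂ) = ∑ q ∈ R, ((a q.1 * a q.2 : ℝ) : ℂ) * fourier ((q.1 : ℤ) - q.2) z := by
      push_cast
      rw [← Complex.mul_conj', hp]
      simp only [map_sum, map_mul, Complex.conj_ofReal, ← fourier_neg]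
      rw [Finset.sum_mul_sum, ← Finset.sum_product']
      refine Finset.sum_congr rfl fun q _ => ?_
      rw [sub_eq_add_neg, fourier_add]; push_cast; ring
    have h2 : ∀ q ∈ R, ((q.1 : ℤ) - q.2) ∈ Finset.Ioo (-(H:ℤ)) H := by
      intro q hq
      simp only [hR, Finset.mem_product, Finset.mem_range] at hq
      simp only [Finset.mem_Ioo]; omega
    push_cast at h1 ⊢
    rw [h1, ← Finset.sum_fiberwise_of_maps_to h2, Finset.sum_div]
    refine Finset.sum_congr rfl fun j _ => ?_
    rw [div_mul_eq_mul_div, Finset.sum_mul]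
    congr 1
    refine Finset.sum_congr rfl fun q hq => ?_
    rw [(Finset.mem_filter.1 hq).2]
  · show (∑ q ∈ R with ((q.1 : ℤ) - q.2 = 0), a q.1 * a q.2) / S = 1
    rw [div_eq_one_iff_eq hSpos.ne', hS]
    refine Finset.sum_bij' (fun q _ => q.1) (fun m _ => (m, m)) ?_ ?_ ?_ ?_ ?_
    · intro q hq; simp [hR] at hq; simp; omega
    · intro m hm; simp [hR]; simpa using hm
    · intro q hq; simp [hR] at hq; ext <;> simp; omega
    · intro m hm; rfl
    · intro q hq; simp [hR] at hq
      have : q.1 = q.2 := by omega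
      rw [this]; ring
  · show (∑ q ∈ R with ((q.1 : ℤ) - q.2 = -1), a q.1 * a q.2) / S = cos θ
    rw [div_eq_iff hSpos.ne']
    have h1 : (∑ q ∈ R with ((q.1 : ℤ) - q.2 = -1), a q.1 * a q.2) =
        ∑ m ∈ Finset.range (H - 1), a m * a (m + 1) := by
      refine Finset.sum_bij' (fun q _ => q.1) (fun m _ => (m, m + 1)) ?_ ?_ ?_ ?_ ?_
      · intro q hq; simp [hR] at hq; simp; omega
      · intro m hm; simp [hR]; simp at hm; omega
      · intro q hq; simp [hR] at hq; ext <;> simp; omega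
      · intro m hm; rfl
      · intro q hq; simp [hR] at hq
        have : q.2 = q.1 + 1 := by omega
        rw [this]
    have h2 := sum_sin_aux θ H
    have h3 : sin ((H + 1 : ℕ) * θ) = 0 := by
      have : ((H + 1 : ℕ) : ℝ) * θ = π := by rw [hθ]; push_cast; field_simp
      rw [this, sin_pi]
    obtain ⟨G, rfl⟩ : ∃ G, H = G + 1 := ⟨H - 1, by omega⟩
    rw [Finset.sum_range_succ' (fun m => sin ((m:ℕ) * θ) * sin ((m + 1 : ℕ) * θ))] at h2
    rw [h3] at h2
    rw [h1]
    simp only [Nat.add_sub_cancel]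
    simp only [Nat.cast_zero, zero_mul, sin_zero, mul_zero, add_zero] at h2
    have h4 : S = ∑ m ∈ Finset.range (G+1), sin ((m + 1 : ℕ) * θ) ^ 2 := rfl
    rw [h4]
    linarith

section four
open UnitAddTorus

lemma kernel (d H : ℕ) (hH : 2 ≤ H) : ∃ (K : Torus d → ℝ) (c : (Fin d → ℤ) → ℝ), Continuous K ∧
    (∀ y, 0 ≤ K y) ∧
    (∀ y, (K y : ℂ) = ∑ h ∈ Fintype.piFinset (fun _ : Fin d => Finset.Ioo (-(H:ℤ)) H),
      (c h : ℂ) * mFourier h y) ∧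
    c 0 = 1 ∧ (∀ h ∈ Fintype.piFinset (fun _ : Fin d => Finset.Ioo (-(H:ℤ)) H), |c h| ≤ 1) ∧
    ∫ y, K y = 1 ∧
    ∀ i, ∫ y, K y * (1 - (fourier 1 (y i) : ℂ).re) = 1 - cos (π / (H + 1)) := by
  obtain ⟨c1, K1, hcont, hpos, hexp, hc0, hc1⟩ := kernel1 H hH
  set B := Fintype.piFinset (fun _ : Fin d => Finset.Ioo (-(H:ℤ)) H) with hB
  set K : Torus d → ℝ := fun y => ∏ i, K1 (y i) with hK
  set c : (Fin d → ℤ) → ℝ := fun h => ∏ i, c1 (h i) with hc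
  have hKc : Continuous K := by fun_prop
  have hKp : ∀ y, 0 ≤ K y := fun y => Finset.prod_nonneg fun i _ => hpos _
  have hKe : ∀ y, (K y : ℂ) = ∑ h ∈ B, (c h : ℂ) * mFourier h y := by
    intro y
    simp only [hK]
    push_cast
    simp only [hexp]
    rw [Finset.prod_univ_sum]
    refine Finset.sum_congr rfl fun h _ => ?_
    simp [hc, mFourier, Finset.prod_mul_distrib]
  have hcc0 : c 0 = 1 := by simp [hc, hc0]
  have hB0 : (0 : Fin d → ℤ) ∈ B := by
    rw [hB, Fintype.mem_piFinset]; intro i; simp; omega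
  have hKi : Integrable K := hKc.integrable_of_hasCompactSupport (HasCompactSupport.of_compactSpace K)
  have hco : ∀ g ∈ B, ∫ y, (K y : ℂ) * mFourier (-g) y = c g := by
    intro g hg
    simp only [hKe, Finset.sum_mul]
    rw [integral_finsetSum]
    · have : ∀ h ∈ B, ∫ y : Torus d, (c h : ℂ) * mFourier h y * mFourier (-g) y =
          if h = g then (c h : ℂ) else 0 := by
        intro h _
        have : ∀ y : Torus d, (c h : ℂ) * mFourier h y * mFourier (-g) y = (c h : ℂ) * mFourier (h + -g) y := by
          intro y; rw [mFourier_add]; ring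
        simp only [this]
        rw [integral_const_mul, integral_mF]
        simp only [← sub_eq_add_neg, sub_eq_zero]
        split_ifs <;> simp
      rw [Finset.sum_congr rfl this, Finset.sum_ite_eq' B g]
      simp [hg]
    · intro h _
      have : (fun y : Torus d => (c h : ℂ) * mFourier h y * mFourier (-g) y) = fun y => (c h : ℂ) * mFourier (h + -g) y := by
          ext y; rw [mFourier_add]; ring
      rw [this]
      exact (integrable_mF _ _).const_mul _
  have hKint1 : ∫ y, K y = 1 := by
    have := hco 0 hB0
    simp only [neg_zero, mFourier_zero, ContinuousMap.one_apply, mul_one] at this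
    rw [integral_complex_ofReal, hcc0] at this
    exact_mod_cast this
  refine ⟨K, c, hKc, hKp, hKe, hcc0, ?_, hKint1, ?_⟩
  · intro h hh
    have h1 := hco h hh
    have h2 : ‖∫ y, (K y : ℂ) * mFourier (-h) y‖ ≤ ∫ y, K y := by
      apply norm_integral_le_of_norm_le hKi
      refine Filter.Eventually.of_forall fun y => ?_
      rw [norm_mul, mF_norm, mul_one, Complex.norm_real, Real.norm_of_nonneg (hKp y)]
    rw [h1, hKint1] at h2
    simpa using h2
  · intro i
    have hmem : -(Pi.single i 1 : Fin d → ℤ) ∈ B := by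
      rw [hB, Fintype.mem_piFinset]; intro j
      by_cases hj : j = i
      · subst hj; simp; omega
      · simp [hj]; omega
    have h1 := hco _ hmem
    rw [neg_neg] at h1
    simp only [mFourier_single] at h1
    have h2 : c (-(Pi.single i 1 : Fin d → ℤ)) = cos (π / (H + 1)) := by
      simp only [hc]
      rw [Finset.prod_eq_single i]
      · simp [hc1]
      · intro j _ hj; simp [hj, hc0]
      · simp
    have hInt : Integrable (fun y : Torus d => (K y : ℂ) * fourier 1 (y i)) := by
      apply Continuous.integrable_of_hasCompactSupport _ (HasCompactSupport.of_compactSpace _)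
      fun_prop
    have h3 : ∫ y, K y * (fourier 1 (y i) : ℂ).re = cos (π / (H + 1)) := by
      have := integral_re hInt
      have h4 : RCLike.re ((cos (π / (H + 1)) : ℝ) : ℂ) = cos (π / (H + 1)) := Complex.ofReal_re _
      rw [h1, h2, h4] at this
      simpa using this
    have hInt2 : Integrable (fun y : Torus d => K y * (fourier 1 (y i) : ℂ).re) := by
      simpa using hInt.re
    simp only [mul_sub, mul_one]
    rw [integral_sub hKi hInt2, hKint1, h3]

end four


lemma err_le_one {d : ℕ} (P : Measure (Torus d)) [IsProbabilityMeasure P] (a b : Fin d → ℝ) :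
    |(P (box a b)).toReal - (volume (box a b)).toReal| ≤ 1 := by
  have h1 : P.real (box a b) ≤ 1 := measureReal_le_one
  have h2 : (volume : Measure (Torus d)).real (box a b) ≤ 1 := measureReal_le_one
  have h3 : 0 ≤ P.real (box a b) := measureReal_nonneg
  have h4 : 0 ≤ (volume : Measure (Torus d)).real (box a b) := measureReal_nonneg
  simp only [Measure.real] at *
  rw [abs_le]; constructor <;> linarith

lemma disc_le {d : ℕ} (P : Measure (Torus d)) (t : ℝ) (ht : 0 ≤ t)
    (h : ∀ a b, |P.real (box a b) - (volume : Measure (Torus d)).real (box a b)| ≤ t) : disc P ≤ t :=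
  Real.iSup_le (fun a => Real.iSup_le (fun b => h a b) ht) ht

lemma le_disc {d : ℕ} (P : Measure (Torus d)) [IsProbabilityMeasure P] (a b : Fin d → ℝ) :
    |P.real (box a b) - (volume : Measure (Torus d)).real (box a b)| ≤ disc P := by
  have h1 : |P.real (box a b) - (volume : Measure (Torus d)).real (box a b)| ≤
      ⨆ b : Fin d → ℝ, |(P (box a b)).toReal - (volume (box a b)).toReal| :=
    le_ciSup (f := fun b : Fin d → ℝ => |(P (box a b)).toReal - (volume (box a b)).toReal|)
      ⟨1, by rintro _ ⟨b, rfl⟩; exact err_le_one P a b⟩ b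
  refine h1.trans ?_
  exact le_ciSup (f := fun a : Fin d → ℝ => ⨆ b : Fin d → ℝ, |(P (box a b)).toReal - (volume (box a b)).toReal|)
      ⟨1, by rintro _ ⟨a, rfl⟩; exact Real.iSup_le (fun b => err_le_one P a b) zero_le_one⟩ a

section four
open UnitAddTorus

/-- Fubini: the smoothed box mass as a finite Fourier sum. -/
lemma smooth_fourier {d : ℕ} (P : Measure (Torus d)) [IsProbabilityMeasure P] (K : Torus d → ℝ)
    (c : (Fin d → ℤ) → ℝ) (B : Finset (Fin d → ℤ)) (hK : Continuous K)
    (hKe : ∀ y, (K y : ℂ) = ∑ h ∈ B, (c h : ℂ) * mFourier h y) (a b : Fin d → ℝ) :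
    ((∫ y, K y * P.real {x | x + y ∈ box a b} : ℝ) : ℂ) =
      ∑ h ∈ B, (c h : ℂ) * boxF a b h * ∫ x, mFourier h (-x) ∂P := by
  set I : Torus d → ℂ := (box a b).indicator 1 with hI
  have hIm : Measurable I := measurable_const.indicator (meas_box a b)
  have hIb : ∀ x, ‖I x‖ ≤ 1 := by
    intro x; by_cases hx : x ∈ box a b <;> simp [hI, hx]
  have hg : ∀ y, ∫ x, I (x + y) ∂P = (P.real {x | x + y ∈ box a b} : ℂ) := by
    intro y
    have : (fun x => I (x + y)) = {x | x + y ∈ box a b}.indicator 1 := by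
      ext x; by_cases hx : x + y ∈ box a b <;> simp [hI, hx]
    have hms : MeasurableSet {x | x + y ∈ box a b} := measurable_add_const y (meas_box a b)
    rw [this, integral_indicator hms]
    simp
  have hcont : Continuous fun y => (K y : ℂ) := by fun_prop
  obtain ⟨M, hM⟩ : ∃ M, ∀ y, ‖(K y : ℂ)‖ ≤ M := by
    obtain ⟨M, hM⟩ := isCompact_univ.exists_bound_of_continuousOn hcont.continuousOn
    exact ⟨M, fun y => hM y (Set.mem_univ y)⟩
  have hInt : Integrable (Function.uncurry fun (y x : Torus d) => (K y : ℂ) * I (x + y))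
      ((volume : Measure (Torus d)).prod P) := by
    refine Integrable.of_bound ?_ M (Filter.Eventually.of_forall ?_)
    · apply Measurable.aestronglyMeasurable
      simp only [Function.uncurry_def]
      exact (hcont.measurable.comp measurable_fst).mul
        (hIm.comp (measurable_snd.add measurable_fst))
    · rintro ⟨y, x⟩
      simp only [Function.uncurry_apply_pair, norm_mul]
      calc _ ≤ M * 1 := mul_le_mul (hM y) (hIb _) (norm_nonneg _) ((norm_nonneg _).trans (hM y))
        _ = M := mul_one M
  have hin : ∀ h x, ∫ y, mFourier h y * I (x + y) = mFourier h (-x) * boxF a b h := by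
    intro h x
    have h1 : ∀ y, mFourier h y * I (x + y) =
        mFourier h (-x) * (box a b).indicator (fun y => mFourier h y) (x + y) := by
      intro y
      by_cases hx : x + y ∈ box a b
      · simp only [hI, hx, Set.indicator_of_mem, Pi.one_apply, mul_one]
        rw [← mF_add]; simp
      · simp [hI, hx]
    simp only [h1]
    rw [integral_const_mul]
    congr 1
    exact integral_add_left_eq_self ((box a b).indicator (fun y => mFourier h y)) x
  rw [← integral_complex_ofReal]
  push_cast
  simp only [← hg, ← integral_const_mul]
  rw [integral_integral_swap hInt]
  have h2 : ∀ x, ∫ y, (K y : ℂ) * I (x + y) =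
      ∑ h ∈ B, (c h : ℂ) * boxF a b h * mFourier h (-x) := by
    intro x
    simp only [hKe, Finset.sum_mul]
    rw [integral_finsetSum]
    · refine Finset.sum_congr rfl fun h _ => ?_
      simp only [mul_assoc]
      rw [integral_const_mul, hin]; ring
    · intro h _
      simp only [mul_assoc]
      apply Integrable.const_mul
      refine Integrable.of_bound ?_ 1 (Filter.Eventually.of_forall ?_)
      · exact ((mFourier h).continuous.measurable.mul
          (hIm.comp (measurable_const_add x))).aestronglyMeasurable
      · intro y
        rw [norm_mul, mF_norm, one_mul]; exact hIb _
  simp only [h2]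
  rw [integral_finsetSum (f := fun h x => (c h : ℂ) * boxF a b h * mFourier h (-x))]
  intro h _
  apply Integrable.const_mul
  refine Integrable.of_bound ?_ 1 (Filter.Eventually.of_forall fun x => (mF_norm h _).le)
  exact ((mFourier h).continuous.comp continuous_neg).aestronglyMeasurable

lemma norm_integral_mF_neg {d : ℕ} (P : Measure (Torus d)) (h : Fin d → ℤ) :
    ‖∫ x, mFourier h (-x) ∂P‖ = ‖∫ x, mFourier h x ∂P‖ := by
  have : ∀ x : Torus d, mFourier h (-x) = (starRingEnd ℂ) (mFourier h x) := by
    intro x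
    rw [← mFourier_neg]
    simp [mFourier, fourier_apply]
  simp only [this]
  rw [integral_conj, RCLike.norm_conj]

lemma re_fourier_one (z : UnitAddCircle) : (fourier 1 z : ℂ).re = cos (2 * π * ‖z‖) := by
  obtain ⟨r, hr⟩ := QuotientAddGroup.mk_surjective z
  subst hr
  have h1 : ‖((r : ℝ) : UnitAddCircle)‖ = |r - round r| := UnitAddCircle.norm_eq
  change (fourier 1 (r : UnitAddCircle) : ℂ).re = cos (2 * π * ‖(r : UnitAddCircle)‖)
  rw [h1, fourier_coe_apply]
  have h2 : (2 * π * Complex.I * (1 : ℤ) * r / (1 : ℝ) : ℂ) = ((2 * π * r : ℝ) : ℂ) * Complex.I := by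
    push_cast; ring
  rw [h2, Complex.exp_ofReal_mul_I_re]
  have h3 : cos (2 * π * |r - round r|) = cos (2 * π * (r - round r)) := by
    rw [← cos_abs (2 * π * (r - round r)), abs_mul, abs_of_pos (by positivity : (0:ℝ) < 2 * π)]
  rw [h3]
  have h4 : 2 * π * (r - round r) = 2 * π * r - (round r : ℤ) * (2 * π) := by ring
  rw [h4, cos_sub_int_mul_two_pi]

lemma smoothing {d : ℕ} (P : Measure (Torus d)) [IsProbabilityMeasure P] (H : ℕ) (hH : 2 ≤ H)
    (δ : ℝ) (hδ : 0 < δ) (hδ2 : δ ≤ 1 / 2)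
    (hτ : d * (1 - cos (π / (H + 1))) ≤ 1 / 4 * (1 - cos (2 * π * δ)))
    (E : ℝ) (hE : ∀ a b, ∑ h ∈ (Fintype.piFinset (fun _ : Fin d => Finset.Ioo (-(H:ℤ)) H)).erase 0,
      ‖boxF a b h‖ * ‖∫ x, mFourier h x ∂P‖ ≤ E) :
    disc P ≤ 3 * d * δ + 2 * E := by
  obtain ⟨K, c, hKc, hKp, hKe, hc0, hcb, hKint1, hmom⟩ := kernel d H hH
  set B := Fintype.piFinset (fun _ : Fin d => Finset.Ioo (-(H:ℤ)) H) with hB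
  have hE0 : 0 ≤ E := le_trans (Finset.sum_nonneg fun h _ => by positivity) (hE 0 0)
  have hB0 : (0 : Fin d → ℤ) ∈ B := by
    rw [hB, Fintype.mem_piFinset]; intro i; simp; omega
  have hKi : Integrable K := hKc.integrable_of_hasCompactSupport (HasCompactSupport.of_compactSpace K)
  set V : (Fin d → ℝ) → (Fin d → ℝ) → ℝ := fun a b => (volume : Measure (Torus d)).real (box a b) with hV
  set g : (Fin d → ℝ) → (Fin d → ℝ) → Torus d → ℝ := fun a b y => P.real {x | x + y ∈ box a b} with hg
  -- smoothed masses are close to volumes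
  have hF : ∀ a b, |(∫ y, K y * g a b y) - V a b| ≤ E := by
    intro a b
    have h1 := smooth_fourier P K c B hKc hKe a b
    rw [← Finset.add_sum_erase B _ hB0, hc0, boxF_zero] at h1
    simp only [mFourier_zero, ContinuousMap.one_apply, integral_const, probReal_univ] at h1
    have h2 : (((∫ y, K y * g a b y) - V a b : ℝ) : ℂ) =
        ∑ h ∈ B.erase 0, (c h : ℂ) * boxF a b h * ∫ x, mFourier h (-x) ∂P := by
      push_cast
      rw [← integral_complex_ofReal] at h1 ⊢
      rw [h1]; simp [hV]
    rw [← Real.norm_eq_abs, ← Complex.norm_real, h2]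
    refine (norm_sum_le _ _).trans (le_trans (Finset.sum_le_sum fun h hh => ?_) (hE a b))
    rw [norm_mul, norm_mul, norm_integral_mF_neg, Complex.norm_real, Real.norm_eq_abs]
    gcongr
    exact mul_le_of_le_one_left (norm_nonneg _) (hcb h (Finset.mem_of_mem_erase hh))
  -- tails
  set U : Set (Torus d) := {y | ∀ i, ‖y i‖ ≤ δ} with hU
  have hUm : MeasurableSet U := by
    have : U = ⋂ i, {y : Torus d | ‖y i‖ ≤ δ} := by ext; simp [hU]
    rw [this]
    refine MeasurableSet.iInter fun i => ?_
    exact measurableSet_le (by fun_prop) measurable_const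
  set τ : ℝ := 1 - cos (2 * π * δ) with hτd
  have hτ0 : 0 < τ := by
    have : cos (2 * π * δ) < cos 0 := by
      apply cos_lt_cos_of_nonneg_of_le_pi le_rfl <;> nlinarith [pi_pos]
    rw [cos_zero] at this; linarith
  have htail : ∫ y in Uᶜ, K y ≤ 1 / 4 := by
    have hi : ∀ i, Integrable (fun y : Torus d => K y * (1 - (fourier 1 (y i) : ℂ).re)) := by
      intro i
      apply Continuous.integrable_of_hasCompactSupport _ (HasCompactSupport.of_compactSpace _)
      have : Continuous fun y : Torus d => (fourier 1 (y i) : ℂ).re :=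
        Complex.continuous_re.comp ((fourier 1).continuous.comp (continuous_apply i))
      fun_prop
    have hnn : ∀ (y : Torus d) i, 0 ≤ 1 - (fourier 1 (y i) : ℂ).re := by
      intro y i; rw [re_fourier_one]; linarith [cos_le_one (2 * π * ‖y i‖)]
    have h1 : τ * ∫ y in Uᶜ, K y ≤ ∑ i, ∫ y, K y * (1 - (fourier 1 (y i) : ℂ).re) := by
      rw [← integral_finsetSum _ (fun i _ => hi i), ← integral_const_mul,
        ← integral_indicator hUm.compl]
      apply integral_mono
      · exact (hKi.const_mul τ).indicator hUm.compl
      · exact integrable_finsetSum _ (fun i _ => hi i)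
      intro y
      by_cases hy : y ∈ U
      · simp only [Set.mem_compl_iff, hy, not_true_eq_false, not_false_eq_true, Set.indicator_of_notMem]
        exact Finset.sum_nonneg fun i _ => mul_nonneg (hKp y) (hnn y i)
      · rw [Set.indicator_of_mem (by exact hy)]
        have : ∃ i, δ < ‖y i‖ := by
          by_contra hc; push Not at hc; exact hy hc
        obtain ⟨i, hi⟩ := this
        calc τ * K y = K y * τ := mul_comm _ _
          _ ≤ K y * (1 - (fourier 1 (y i) : ℂ).re) := by
            apply mul_le_mul_of_nonneg_left _ (hKp y)
            rw [re_fourier_one, hτd]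
            have h3 : ‖y i‖ ≤ 1 / 2 := by simpa using AddCircle.norm_le_half_period (1:ℝ) one_ne_zero (x := y i)
            have : cos (2 * π * ‖y i‖) ≤ cos (2 * π * δ) := by
              apply cos_le_cos_of_nonneg_of_le_pi
              · positivity
              · nlinarith [pi_pos]
              · gcongr
            linarith
          _ ≤ _ := Finset.single_le_sum (f := fun i => K y * (1 - (fourier 1 (y i) : ℂ).re))
              (fun i _ => mul_nonneg (hKp y) (hnn y i)) (Finset.mem_univ i)
    simp only [hmom, Finset.sum_const, Finset.card_univ, Fintype.card_fin, nsmul_eq_mul] at h1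
    have : τ * ∫ y in Uᶜ, K y ≤ τ * (1 / 4) := by linarith
    exact le_of_mul_le_mul_left this hτ0
  set m := ∫ y in U, K y with hm
  have hmt : m + ∫ y in Uᶜ, K y = 1 := by rw [hm, integral_add_compl hUm hKi, hKint1]
  have hm4 : 3 / 4 ≤ m := by linarith
  have hm1 : 0 ≤ ∫ y in Uᶜ, K y := integral_nonneg hKp
  -- basic properties of g
  have hgm : ∀ a b, Measurable (g a b) := by
    intro a b
    have : MeasurableSet {p : Torus d × Torus d | p.2 + p.1 ∈ box a b} :=
      (measurable_snd.add measurable_fst) (meas_box a b)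
    exact (measurable_measure_prodMk_left this).ennreal_toReal
  have hg1 : ∀ a b y, g a b y ≤ 1 := fun a b y => measureReal_le_one
  have hg0 : ∀ a b y, 0 ≤ g a b y := fun a b y => measureReal_nonneg
  have hKg : ∀ a b, Integrable fun y => K y * g a b y := by
    intro a b
    refine hKi.mono' (hKc.measurable.mul (hgm a b)).aestronglyMeasurable
      (Filter.Eventually.of_forall fun y => ?_)
    rw [norm_mul, norm_of_nonneg (hKp y), norm_of_nonneg (hg0 _ _ _)]
    exact mul_le_of_le_one_right (hKp y) (hg1 _ _ _)
  have hgV : ∀ a b y, |g a b y - V a b| ≤ disc P := by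
    intro a b y
    obtain ⟨t, ht, -⟩ := torus_lift y
    have h1 : V a b = (volume : Measure (Torus d)).real {x | x + y ∈ box a b} := by
      have := measure_preimage_add_right (volume : Measure (Torus d)) y (box a b)
      simp only [hV, Measure.real]
      rw [← this]; rfl
    rw [h1]
    simp only [hg, box_translate a b t y ht]
    exact le_disc P _ _
  have hsplit : ∀ a b, ∫ y, K y * g a b y = (∫ y in U, K y * g a b y) + ∫ y in Uᶜ, K y * g a b y :=
    fun a b => (integral_add_compl hUm (hKg a b)).symm
  set D := disc P with hD
  have hD0 : 0 ≤ D := (abs_nonneg _).trans (le_disc P 0 0)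
  have key : ∀ a b, |P.real (box a b) - V a b| ≤ 2 * d * δ + 4 / 3 * E + D / 3 := by
    intro a b
    rw [abs_le]
    constructor
    · -- lower bound
      set a' : Fin d → ℝ := fun i => a i + δ
      set b' : Fin d → ℝ := fun i => b i - δ
      have hvol : V a b ≤ V a' b' + 2 * d * δ := by
        have := vol_box_expand a' b' δ hδ.le
        simpa [a', b', hV] using this
      have hin : ∀ y ∈ U, g a' b' y ≤ P.real (box a b) := by
        intro y hy
        obtain ⟨t, ht, ht2⟩ := torus_lift y
        simp only [hg, box_translate a' b' t y ht]
        refine measureReal_mono (box_mono ?_ ?_)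
        · intro i; have := abs_le.1 ((ht2 i).le.trans (hy i)); simp only [a']; linarith
        · intro i; have := abs_le.1 ((ht2 i).le.trans (hy i)); simp only [b']; linarith
      have h1 : ∫ y in U, K y * g a' b' y ≤ m * P.real (box a b) := by
        rw [hm, ← integral_mul_const]
        apply setIntegral_mono_on (hKg _ _).integrableOn (hKi.mul_const _).integrableOn hUm
        intro y hy
        exact mul_le_mul_of_nonneg_left (hin y hy) (hKp y)
      have h2 : ∫ y in Uᶜ, K y * g a' b' y ≤ (∫ y in Uᶜ, K y) * (V a' b' + D) := by
        rw [← integral_mul_const]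
        apply setIntegral_mono_on (hKg _ _).integrableOn (hKi.mul_const _).integrableOn hUm.compl
        intro y hy
        exact mul_le_mul_of_nonneg_left (by linarith [(abs_le.1 (hgV a' b' y)).2]) (hKp y)
      have h3 := (abs_le.1 (hF a' b')).1
      rw [hsplit] at h3
      have h4 : ∫ y in Uᶜ, K y = 1 - m := by linarith
      rw [h4] at h2
      by_contra hc
      push Not at hc
      have h5 : 0 ≤ m - 3 / 4 := by linarith
      have h6 : m * (V a' b' - P.real (box a b)) ≤ E + (1 - m) * D := by nlinarith
      have h7 : 4 / 3 * E + D / 3 < V a' b' - P.real (box a b) := by linarith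
      have h8 : m * (4 / 3 * E + D / 3) < m * (V a' b' - P.real (box a b)) :=
        mul_lt_mul_of_pos_left h7 (by linarith)
      nlinarith
    · set a' : Fin d → ℝ := fun i => a i - δ
      set b' : Fin d → ℝ := fun i => b i + δ
      have hvol : V a' b' ≤ V a b + 2 * d * δ := vol_box_expand a b δ hδ.le
      have hin : ∀ y ∈ U, P.real (box a b) ≤ g a' b' y := by
        intro y hy
        obtain ⟨t, ht, ht2⟩ := torus_lift y
        simp only [hg, box_translate a' b' t y ht]
        refine measureReal_mono (box_mono ?_ ?_)
        · intro i; have := abs_le.1 ((ht2 i).le.trans (hy i)); simp only [a']; linarith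
        · intro i; have := abs_le.1 ((ht2 i).le.trans (hy i)); simp only [b']; linarith
      have h1 : m * P.real (box a b) ≤ ∫ y in U, K y * g a' b' y := by
        rw [hm, ← integral_mul_const]
        apply setIntegral_mono_on (hKi.mul_const _).integrableOn (hKg _ _).integrableOn hUm
        intro y hy
        exact mul_le_mul_of_nonneg_left (hin y hy) (hKp y)
      have h2 : (∫ y in Uᶜ, K y) * (V a' b' - D) ≤ ∫ y in Uᶜ, K y * g a' b' y := by
        rw [← integral_mul_const]
        apply setIntegral_mono_on (hKi.mul_const _).integrableOn (hKg _ _).integrableOn hUm.compl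
        intro y hy
        exact mul_le_mul_of_nonneg_left (by linarith [(abs_le.1 (hgV a' b' y)).1]) (hKp y)
      have h3 := (abs_le.1 (hF a' b')).2
      rw [hsplit] at h3
      have h4 : ∫ y in Uᶜ, K y = 1 - m := by linarith
      rw [h4] at h2
      by_contra hc
      push Not at hc
      have h6 : m * (P.real (box a b) - V a' b') ≤ E + (1 - m) * D := by nlinarith
      have h7 : 4 / 3 * E + D / 3 < P.real (box a b) - V a' b' := by linarith
      have h8 : m * (4 / 3 * E + D / 3) < m * (P.real (box a b) - V a' b') :=
        mul_lt_mul_of_pos_left h7 (by linarith)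
      nlinarith
  have h9 : D ≤ 2 * d * δ + 4 / 3 * E + D / 3 := disc_le P _ (by positivity) key
  linarith

end four


lemma prob_gen {n d : ℕ} (hn : 0 < n) (α : Fin n → Fin d → ℝ) : IsProbabilityMeasure (genMeasure α) := by
  constructor
  simp only [genMeasure, Measure.smul_apply, Measure.finsetSum_apply, Measure.add_apply, measure_univ]
  simp only [Finset.sum_const, Finset.card_univ, Fintype.card_fin, nsmul_eq_mul, smul_eq_mul]
  have h1 : (n : ENNReal) * (1 + 1) = 2 * n := by rw [mul_comm]; norm_num
  rw [h1]
  apply ENNReal.inv_mul_cancel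
  · simp; omega
  · exact ENNReal.mul_ne_top (by simp) (by simp)

lemma prob_pow {d : ℕ} (μ : Measure (Torus d)) [IsProbabilityMeasure μ] (k : ℕ) :
    IsProbabilityMeasure (convPow μ k) := by
  induction k with
  | zero => simp only [convPow]; infer_instance
  | succ k ih => simp only [convPow]; infer_instance

section four
open UnitAddTorus

lemma fourier_pow {d : ℕ} (μ : Measure (Torus d)) [IsProbabilityMeasure μ] (k : ℕ) (h : Fin d → ℤ) :
    ∫ x, mFourier h x ∂(convPow μ k) = (∫ x, mFourier h x ∂μ) ^ k := by
  induction k with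
  | zero =>
    simp only [convPow, integral_dirac, pow_zero]
    simp [mFourier]
  | succ k ih =>
    have := prob_pow μ k
    simp only [convPow]
    rw [integral_conv (integrable_mF _ h)]
    simp only [mF_add, integral_const_mul]
    rw [integral_mul_const, ih, pow_succ]

lemma mF_toTorus {d : ℕ} (h : Fin d → ℤ) (v : Fin d → ℝ) :
    mFourier h (toTorus v) = Complex.exp (((2 * π * ∑ i, v i * h i : ℝ) : ℂ) * Complex.I) := by
  simp only [mFourier, ContinuousMap.coe_mk, toTorus, fourier_coe_apply]
  rw [← Complex.exp_sum]
  congr 1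
  push_cast
  rw [Finset.mul_sum, Finset.sum_mul]
  refine Finset.sum_congr rfl fun i _ => ?_
  ring

lemma fourier_gen {n d : ℕ} (hn : 0 < n) (α : Fin n → Fin d → ℝ) (h : Fin d → ℤ) :
    ∫ x, mFourier h x ∂(genMeasure α) =
      (((1 / n : ℝ) * ∑ j, cos (2 * π * ∑ i, α j i * h i) : ℝ) : ℂ) := by
  have hneg : ∀ x : Torus d, mFourier h (-x) = (starRingEnd ℂ) (mFourier h x) := by
    intro x
    rw [← mFourier_neg]
    simp [mFourier, fourier_apply]
  simp only [genMeasure]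
  rw [integral_smul_measure, integral_finsetSum_measure (fun j _ => integrable_mF _ h)]
  have : ∀ j, ∫ x, mFourier h x ∂(Measure.dirac (toTorus (α j)) + Measure.dirac (-(toTorus (α j)))) =
      ((2 * cos (2 * π * ∑ i, α j i * h i) : ℝ) : ℂ) := by
    intro j
    rw [integral_add_measure (integrable_mF _ h) (integrable_mF _ h), integral_dirac, integral_dirac,
      hneg, Complex.add_conj, mF_toTorus, Complex.exp_ofReal_mul_I_re]
  simp only [this]
  rw [← Complex.ofReal_sum, ← Finset.mul_sum, Complex.real_smul, ← Complex.ofReal_mul]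
  congr 1
  simp only [ENNReal.toReal_inv, ENNReal.toReal_mul, ENNReal.toReal_ofNat, ENNReal.toReal_natCast]
  have : (n : ℝ) ≠ 0 := by positivity
  field_simp

lemma cos_quad (w : ℝ) (h0 : 0 ≤ w) (h1 : w ≤ 1 / 2) : cos (π * w) ≤ 1 - 4 * w ^ 2 := by
  have hc := strictConcaveOn_sin_Icc.concaveOn
  have hc2 := hc.2
  have h2 := @hc2 0 ⟨le_rfl, pi_pos.le⟩ (π / 4) ⟨by positivity, by linarith [pi_pos]⟩
    (1 - 2 * w) (2 * w) (by linarith) (by linarith) (by ring)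
  simp only [smul_eq_mul, sin_zero, mul_zero, zero_add, sin_pi_div_four] at h2
  have h3 : 2 * w * (π / 4) = π * w / 2 := by ring
  rw [h3] at h2
  have h4 : cos (π * w) = 1 - 2 * sin (π * w / 2) ^ 2 := by
    have : π * w = 2 * (π * w / 2) := by ring
    rw [this, cos_two_mul, cos_sq']; ring_nf
  have h5 : (2 * w * (√2 / 2)) ^ 2 ≤ sin (π * w / 2) ^ 2 := by
    apply pow_le_pow_left₀ (by positivity) h2
  have h6 : (2 * w * (√2 / 2)) ^ 2 = 2 * w ^ 2 := by
    have := Real.sq_sqrt (show (0:ℝ) ≤ 2 by norm_num)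
    calc _ = w ^ 2 * √2 ^ 2 := by ring
      _ = _ := by rw [this]; ring
  rw [h4]; linarith

lemma intDist_nonneg (x : ℝ) : 0 ≤ intDist x := abs_nonneg _

lemma intDist_le_half (x : ℝ) : intDist x ≤ 1 / 2 := abs_sub_round x

lemma abs_cos_le (z : ℝ) : |cos (2 * π * z)| ≤ 1 - 4 * intDist (2 * z) ^ 2 := by
  have h1 : |cos (2 * π * z)| = cos (π * intDist (2 * z)) := by
    have h2 : cos (π * intDist (2 * z)) = cos (π * (2 * z - round (2 * z))) := by
      rw [intDist, ← cos_abs (π * (2 * z - round (2 * z))), abs_mul, abs_of_pos pi_pos]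
    have h3 : π * (2 * z - round (2 * z)) = 2 * π * z - (round (2 * z) : ℤ) * π := by ring
    have h4 : 0 ≤ cos (π * intDist (2 * z)) := by
      have := intDist_nonneg (2 * z)
      have := intDist_le_half (2 * z)
      apply cos_nonneg_of_mem_Icc
      constructor <;> nlinarith [pi_pos]
    rw [← abs_of_nonneg h4, h2, h3, cos_sub_int_mul_pi, abs_mul]
    simp
  rw [h1]
  exact cos_quad _ (intDist_nonneg _) (intDist_le_half _)

lemma fourier_bound {n d : ℕ} (hn : 0 < n) (A : Matrix (Fin n) (Fin d) ℝ) (k : ℕ) (h : Fin d → ℤ) :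
    ‖∫ x, mFourier h x ∂(convPow (genMeasure (fun j => A j)) k)‖ ≤
      exp (-(4 * k / n) * ∑ j, intDist (2 * A.mulVec (fun i => (h i : ℝ)) j) ^ 2) := by
  have := prob_gen hn (fun j => A j)
  rw [fourier_pow, fourier_gen hn, norm_pow, Complex.norm_real, Real.norm_eq_abs, abs_mul]
  have hn' : (0 : ℝ) < n := by exact_mod_cast hn
  set S := ∑ j, intDist (2 * A.mulVec (fun i => (h i : ℝ)) j) ^ 2 with hS
  have h1 : |(1 / n : ℝ)| * |∑ j, cos (2 * π * ∑ i, A j i * h i)| ≤ exp (-(4 / n) * S) := by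
    calc _ ≤ (1 / n : ℝ) * ∑ j, |cos (2 * π * ∑ i, A j i * h i)| := by
          rw [abs_of_pos (by positivity)]
          gcongr
          exact Finset.abs_sum_le_sum_abs _ _
      _ ≤ (1 / n : ℝ) * ∑ j, (1 - 4 * intDist (2 * A.mulVec (fun i => (h i : ℝ)) j) ^ 2) := by
          gcongr with j
          exact abs_cos_le _
      _ = -(4 / n) * S + 1 := by
          rw [Finset.sum_sub_distrib, ← Finset.mul_sum]
          simp only [Finset.sum_const, Finset.card_univ, Fintype.card_fin, nsmul_eq_mul]
          field_simp; ring
      _ ≤ _ := add_one_le_exp _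
  calc _ ≤ exp (-(4 / n) * S) ^ k := pow_le_pow_left₀ (by positivity) h1 k
    _ = _ := by rw [← exp_nat_mul]; congr 1; ring

end four


lemma intDist_le_abs (x : ℝ) (m : ℤ) : intDist x ≤ |x - m| := round_le x m

noncomputable def cellW (q : ℝ) (m : ℤ) : ℝ := if 0 ≤ m then q ^ m.toNat else q ^ (-m - 1).toNat

lemma cellW_nonneg (q : ℝ) (hq : 0 ≤ q) (m : ℤ) : 0 ≤ cellW q m := by
  unfold cellW; split_ifs <;> positivity

lemma geom_finset (q : ℝ) (h0 : 0 ≤ q) (h1 : q < 1) (s : Finset ℕ) : ∑ i ∈ s, q ^ i ≤ 1 / (1 - q) := by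
  rw [one_div, ← tsum_geometric_of_lt_one h0 h1]
  exact (summable_geometric_of_lt_one h0 h1).sum_le_tsum s (fun i _ => by positivity)

lemma cellW_sum (q : ℝ) (h0 : 0 ≤ q) (h1 : q < 1) (s : Finset ℤ) :
    ∑ m ∈ s, cellW q m ≤ 2 / (1 - q) := by
  rw [← Finset.sum_filter_add_sum_filter_not s (fun m => 0 ≤ m)]
  have ha : ∑ m ∈ s with 0 ≤ m, cellW q m ≤ 1 / (1 - q) := by
    have : ∑ m ∈ s with 0 ≤ m, cellW q m = ∑ i ∈ (s.filter (fun m => 0 ≤ m)).image Int.toNat, q ^ i := by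
      rw [Finset.sum_image]
      · refine Finset.sum_congr rfl fun m hm => ?_
        rw [Finset.mem_filter] at hm
        simp [cellW, hm.2]
      · intro a ha b hb hab
        simp only [Finset.coe_filter, Set.mem_ofPred_eq] at ha hb
        omega
    rw [this]; exact geom_finset q h0 h1 _
  have hb : ∑ m ∈ s with ¬ 0 ≤ m, cellW q m ≤ 1 / (1 - q) := by
    have : ∑ m ∈ s with ¬ 0 ≤ m, cellW q m =
        ∑ i ∈ (s.filter (fun m => ¬ 0 ≤ m)).image (fun m => (-m - 1).toNat), q ^ i := by
      rw [Finset.sum_image]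
      · refine Finset.sum_congr rfl fun m hm => ?_
        rw [Finset.mem_filter] at hm
        simp [cellW, hm.2]
      · intro a ha b hb hab
        simp only [Finset.coe_filter, Set.mem_ofPred_eq] at ha hb
        simp only at hab
        omega
    rw [this]; exact geom_finset q h0 h1 _
  have : 2 / (1 - q) = 1 / (1 - q) + 1 / (1 - q) := by ring
  linarith

lemma cell_bound (κ δ N : ℝ) (hκ : 0 ≤ κ) (hδ : 0 < δ) (hN : 0 ≤ N) (h : N ≤ κ * δ ^ 2) (r : ℝ) :
    exp (-κ * |r| ^ 2) ≤ cellW (exp (-N)) ⌊r / δ⌋ := by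
  set m := ⌊r / δ⌋ with hm
  have h1 : (m : ℝ) ≤ r / δ := Int.floor_le _
  have h2 : r / δ < m + 1 := Int.lt_floor_add_one _
  have key : ∀ t : ℕ, (t : ℝ) * δ ≤ |r| → exp (-κ * |r| ^ 2) ≤ exp (-N) ^ t := by
    intro t ht
    rw [← exp_nat_mul]
    apply exp_le_exp.2
    have e1 : ((t : ℝ) * δ) ^ 2 ≤ |r| ^ 2 := pow_le_pow_left₀ (by positivity) ht 2
    have e2 : (t : ℝ) ≤ (t : ℝ) ^ 2 := by exact_mod_cast Nat.le_self_pow (by norm_num) t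
    have e3 : κ * (((t : ℝ) * δ) ^ 2) ≤ κ * |r| ^ 2 := by gcongr
    have e4 : (t : ℝ) ^ 2 * N ≤ (t : ℝ) ^ 2 * (κ * δ ^ 2) := by gcongr
    have e5 : (t : ℝ) * N ≤ (t : ℝ) ^ 2 * N := by gcongr
    nlinarith
  unfold cellW
  split_ifs with h0
  · apply key
    have : ((m.toNat : ℕ) : ℝ) = (m : ℝ) := by exact_mod_cast Int.toNat_of_nonneg h0
    rw [this]
    rw [le_div_iff₀ hδ] at h1
    exact h1.trans (le_abs_self _)
  · apply key
    have : (((-m - 1).toNat : ℕ) : ℝ) = -(m : ℝ) - 1 := by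
      have : (((-m - 1).toNat : ℕ) : ℤ) = -m - 1 := Int.toNat_of_nonneg (by omega)
      exact_mod_cast this
    rw [this]
    rw [div_lt_iff₀ hδ] at h2
    have := neg_le_abs r
    nlinarith

lemma class_sum {ι : Type*} {n : ℕ} (hn : 0 < n) (S : Finset ι) (y : ι → Fin n → ℝ) (κ δ : ℝ) (hκ : 0 ≤ κ)
    (hδ : 0 < δ) (hκδ : (n : ℝ) ≤ κ * δ ^ 2)
    (hsep : ∀ h ∈ S, ∀ h' ∈ S, h ≠ h' → ∃ j, δ ≤ intDist (y h j - y h' j)) :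
    ∑ h ∈ S, exp (-κ * ∑ j, intDist (y h j) ^ 2) ≤ (2 / (1 - exp (-(n : ℝ)))) ^ n := by
  classical
  have hn' : (0 : ℝ) < n := by exact_mod_cast hn
  set q := exp (-(n : ℝ)) with hq
  have hq1 : q < 1 := by rw [hq]; rw [← exp_zero]; exact exp_lt_exp.2 (by linarith)
  let M : ι → Fin n → ℤ := fun h j => ⌊(y h j - round (y h j)) / δ⌋
  have hinj : Set.InjOn M S := by
    intro a ha b hb hab
    by_contra hne
    obtain ⟨j, hj⟩ := hsep a ha b hb hne
    have h1 : ⌊(y a j - round (y a j)) / δ⌋ = ⌊(y b j - round (y b j)) / δ⌋ := congrFun hab j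
    have h2 := Int.abs_sub_lt_one_of_floor_eq_floor h1
    rw [← sub_div, abs_div, abs_of_pos hδ, div_lt_one hδ] at h2
    have h3 := intDist_le_abs (y a j - y b j) (round (y a j) - round (y b j))
    push_cast at h3
    have h4 : y a j - y b j - ((round (y a j) : ℝ) - round (y b j)) =
      y a j - round (y a j) - (y b j - round (y b j)) := by ring
    rw [h4] at h3
    linarith
  calc ∑ h ∈ S, exp (-κ * ∑ j, intDist (y h j) ^ 2)
      ≤ ∑ h ∈ S, ∏ j, cellW q (M h j) := by
        apply Finset.sum_le_sum
        intro h _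
        rw [Finset.mul_sum, exp_sum]
        apply Finset.prod_le_prod
        · intros; positivity
        · intro j _
          exact cell_bound κ δ n hκ hδ hn'.le hκδ _
    _ = ∑ m ∈ S.image M, ∏ j, cellW q (m j) := by
        rw [Finset.sum_image hinj]
    _ ≤ ∑ m ∈ Fintype.piFinset (fun j => (S.image M).image (fun m => m j)), ∏ j, cellW q (m j) := by
        apply Finset.sum_le_sum_of_subset_of_nonneg
        · intro m hm
          rw [Fintype.mem_piFinset]
          intro j
          exact Finset.mem_image_of_mem _ hm
        · intro m _ _
          exact Finset.prod_nonneg fun j _ => cellW_nonneg q (exp_pos _).le _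
    _ = ∏ j, ∑ m ∈ (S.image M).image (fun m => m j), cellW q m := by
        rw [Finset.prod_univ_sum]
    _ ≤ ∏ j : Fin n, (2 / (1 - q)) := by
        apply Finset.prod_le_prod
        · intro j _
          exact Finset.sum_nonneg fun m _ => cellW_nonneg q (exp_pos _).le _
        · intro j _
          exact cellW_sum q (exp_pos _).le hq1 _
    _ = _ := by rw [Finset.prod_const, Finset.card_univ, Fintype.card_fin]

/-- Pointwise bound for a single frequency. -/
lemma single_bound (n d : ℕ) (hn : 0 < n) (hd : 0 < d) (κ δ u c S : ℝ) (hu : 1 ≤ u) (hc : 0 < c)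
    (hc2 : c ^ 2 = 4 / 3) (hκ : 0 ≤ κ)
    (hκδ : κ * δ ^ 2 = n * c ^ (2 * ((d : ℝ) / n)))
    (hS : (δ * u ^ ((d : ℝ) / n)) ^ 2 ≤ S) :
    exp (-κ * S) ≤ exp (-(n : ℝ)) * (3 / 4) ^ d / u := by
  have hn' : (0 : ℝ) < n := by exact_mod_cast hn
  have hu0 : 0 < u := by linarith
  have h1 : κ * (δ * u ^ ((d : ℝ) / n)) ^ 2 = n * (c * u) ^ (2 * ((d : ℝ) / n)) := by
    rw [mul_pow, ← mul_assoc, hκδ, mul_rpow hc.le hu0.le, mul_comm 2 ((d : ℝ) / n), rpow_mul hu0.le, rpow_ofNat]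
    ring
  have h2 : n + 2 * d * log (c * u) ≤ n * (c * u) ^ (2 * ((d : ℝ) / n)) := by
    rw [rpow_def_of_pos (by positivity)]
    have := add_one_le_exp (log (c * u) * (2 * ((d : ℝ) / n)))
    calc _ = n * (log (c * u) * (2 * ((d : ℝ) / n)) + 1) := by field_simp; ring
      _ ≤ _ := by gcongr
  have h3 : κ * (δ * u ^ ((d : ℝ) / n)) ^ 2 ≤ κ * S := by gcongr
  calc exp (-κ * S) ≤ exp (-n - (2 * d : ℕ) * log (c * u)) := by
        apply exp_le_exp.2; push_cast; linarith
    _ = exp (-n) / (c * u) ^ (2 * d) := by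
        rw [exp_sub, ← log_pow, exp_log (by positivity)]
    _ = exp (-n) * (3 / 4) ^ d / u ^ (2 * d) := by
        rw [mul_pow, pow_mul, hc2]
        rw [show (4 / 3 : ℝ) = (3 / 4)⁻¹ by norm_num, inv_pow]
        field_simp
    _ ≤ _ := by
        gcongr
        exact le_self_pow₀ hu (by omega)

lemma const_bound (n : ℕ) (hn : 0 < n) : exp (-(n : ℝ)) * (2 / (1 - exp (-(n : ℝ)))) ^ n ≤ 2 := by
  have e1 := exp_one_gt_d9
  have h0 : exp (-(n : ℝ)) = exp (-1) ^ n := by rw [← exp_nat_mul]; congr 1; ring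
  have hlt : exp (-1) < 0.37 := by
    rw [exp_neg]
    rw [inv_lt_comm₀ (exp_pos _) (by norm_num)]
    norm_num at e1 ⊢; linarith
  have hp := exp_pos (-1)
  have hm : exp (-(n : ℝ)) ≤ exp (-1) := by
    apply exp_le_exp.2
    have : (1 : ℝ) ≤ n := by exact_mod_cast hn
    linarith
  rcases Nat.lt_or_ge n 2 with h | h
  · have : n = 1 := by omega
    subst this
    simp only [Nat.cast_one, pow_one]
    rw [← mul_div_assoc, div_le_iff₀ (by linarith)]
    linarith
  · have hm2 : exp (-(n : ℝ)) ≤ exp (-1) ^ 2 := by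
      rw [← exp_nat_mul]
      apply exp_le_exp.2
      have : (2 : ℝ) ≤ n := by exact_mod_cast h
      push_cast; linarith
    nth_rewrite 1 [h0]
    rw [← mul_pow]
    have : (exp (-1) * (2 / (1 - exp (-(n : ℝ))))) ^ n ≤ 1 := by
      apply pow_le_one₀
      · have : 0 < 1 - exp (-(n : ℝ)) := by linarith
        positivity
      · rw [← mul_div_assoc, div_le_one (by linarith)]
        nlinarith
    linarith


lemma E_bound (n d : ℕ) (hn : 0 < n) (hd : 0 < d) (A : Matrix (Fin n) (Fin d) ℝ) (k : ℕ)
    (δ H0 c : ℝ) (H : ℕ) (hδ : 0 < δ) (hH0 : 0 < H0) (hH : (H : ℝ) < H0 + 1) (hc1 : 1 ≤ c)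
    (hc2 : c ^ 2 = 4 / 3) (hκδ : (2 * k / n : ℝ) * δ ^ 2 = n * c ^ (2 * ((d : ℝ) / n)))
    (hgap : ∀ g : Fin d → ℤ, g ≠ 0 → ∃ j, δ * (2 * H0 / ‖g‖) ^ ((d : ℝ) / n) ≤
      intDist (A.mulVec (fun i => (g i : ℝ)) j)) (a b : Fin d → ℝ) :
    ∑ h ∈ (Fintype.piFinset (fun _ : Fin d => Finset.Ioo (-(H:ℤ)) H)).erase 0,
      ‖boxF a b h‖ * ‖∫ x, UnitAddTorus.mFourier h x ∂(convPow (genMeasure (fun j => A j)) k)‖ ≤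
      (3 / 2) ^ d / H0 := by
  classical
  have hn' : (0 : ℝ) < n := by exact_mod_cast hn
  set κ : ℝ := 2 * k / n with hκ
  have hκ0 : 0 ≤ κ := by positivity
  have hpp : 0 ≤ (d : ℝ) / n := by positivity
  set y : (Fin d → ℤ) → Fin n → ℝ := fun h j => 2 * A.mulVec (fun i => (h i : ℝ)) j with hy
  set s := (Fintype.piFinset (fun _ : Fin d => Finset.Ioo (-(H:ℤ)) H)).erase 0 with hs
  set F : (Fin d → ℤ) → ℝ := fun h => exp (-κ * ∑ j, intDist (y h j) ^ 2) with hF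
  set B : ℝ := 1 / 2 * (exp (-(n : ℝ)) * (3 / 4) ^ d / H0) with hB
  have hB0 : 0 ≤ B := by positivity
  -- linearity
  have hlin : ∀ h h' : Fin d → ℤ, ∀ j, y h j - y h' j =
      A.mulVec (fun i => (((2 • (h - h')) i : ℤ) : ℝ)) j := by
    intro h h' j
    simp only [hy, Matrix.mulVec, dotProduct]
    rw [← mul_sub, ← Finset.sum_sub_distrib, Finset.mul_sum]
    refine Finset.sum_congr rfl fun i _ => ?_
    simp only [Pi.smul_apply, Pi.sub_apply]
    push_cast [nsmul_eq_mul]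
    ring
  have hlin0 : ∀ h : Fin d → ℤ, ∀ j, y h j = A.mulVec (fun i => (((2 • h) i : ℤ) : ℝ)) j := by
    intro h j
    have := hlin h 0 j
    simpa [hy, Matrix.mulVec, dotProduct] using this
  have hnorm2 : ∀ g : Fin d → ℤ, ‖2 • g‖ = 2 * ‖g‖ := by
    intro g
    have e1 : ∀ x : Fin d → ℤ, ‖x‖ = ‖(fun i => ((x i : ℤ) : ℝ) : Fin d → ℝ)‖ := by
      intro x
      simp [Pi.norm_def, ← Int.norm_cast_real]
      rfl
    rw [e1, e1 g]
    have : (fun i => (((2 • g) i : ℤ) : ℝ)) = (2 : ℝ) • (fun i => ((g i : ℤ) : ℝ) : Fin d → ℝ) := by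
      ext i; simp
    rw [this, norm_smul]; norm_num
  have hpos : ∀ g : Fin d → ℤ, g ≠ 0 → 0 < ‖g‖ := fun g hg => norm_pos_iff.2 hg
  have hlt : ∀ g : Fin d → ℤ, (∀ i, |g i| ≤ (H : ℤ) - 1) → ‖g‖ ≤ H0 := by
    intro g hg
    rw [pi_norm_le_iff_of_nonneg hH0.le]
    intro i
    rw [Int.norm_eq_abs]
    have := hg i
    have : (|(g i : ℝ)|) ≤ (H : ℝ) - 1 := by exact_mod_cast this
    linarith
  -- pointwise
  have hpt : ∀ h ∈ s, ‖boxF a b h‖ *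
      ‖∫ x, UnitAddTorus.mFourier h x ∂(convPow (genMeasure (fun j => A j)) k)‖ ≤ B * F h := by
    intro h hh
    rw [hs, Finset.mem_erase, Fintype.mem_piFinset] at hh
    obtain ⟨h0, hh⟩ := hh
    have hN := hpos h h0
    have hNH : ‖h‖ ≤ H0 := by
      apply hlt
      intro i
      have := hh i
      rw [Finset.mem_Ioo] at this
      rw [abs_le]; constructor <;> omega
    have hf : ‖∫ x, UnitAddTorus.mFourier h x ∂(convPow (genMeasure (fun j => A j)) k)‖ ≤ F h * F h := by
      refine (fourier_bound hn A k h).trans (le_of_eq ?_)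
      simp only [hF]
      rw [← exp_add]; congr 1; simp only [hy, hκ]; ring
    have hb : ‖boxF a b h‖ ≤ 1 / (2 * ‖h‖) := by
      have : Nonempty (Fin d) := ⟨⟨0, hd⟩⟩
      obtain ⟨i, hi⟩ : ∃ i, ‖h‖ = |(h i : ℝ)| := by
        obtain ⟨i, hi⟩ := Finite.exists_max (fun i => ‖h i‖)
        refine ⟨i, le_antisymm ?_ ?_⟩
        · rw [pi_norm_le_iff_of_nonneg (abs_nonneg _)]
          intro j; rw [← Int.norm_eq_abs]; exact hi j
        · rw [← Int.norm_eq_abs]; exact norm_le_pi_norm h i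
      rw [hi]
      apply boxF_le
      intro h1
      rw [h1] at hi
      simp at hi
      exact h0 hi
    have hF1 : F h ≤ exp (-(n : ℝ)) * (3 / 4) ^ d / (H0 / ‖h‖) := by
      have h2 : (2 : ℕ) • h ≠ 0 := by
        intro h2
        have := hnorm2 h
        rw [h2, norm_zero] at this
        linarith
      obtain ⟨j, hj⟩ := hgap (2 • h) h2
      rw [hnorm2, ← hlin0, mul_div_mul_left _ _ (by norm_num : (2 : ℝ) ≠ 0)] at hj
      refine single_bound n d hn hd κ δ (H0 / ‖h‖) c _ ?_ (by linarith) hc2 hκ0 hκδ ?_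
      · rw [le_div_iff₀ hN]; linarith
      · refine (pow_le_pow_left₀ (by positivity) hj 2).trans ?_
        exact Finset.single_le_sum (f := fun j => intDist (y h j) ^ 2) (fun j _ => sq_nonneg _) (Finset.mem_univ j)
    have hF0 : 0 ≤ F h := (exp_pos _).le
    calc _ ≤ 1 / (2 * ‖h‖) * (F h * F h) := by gcongr
      _ ≤ 1 / (2 * ‖h‖) * ((exp (-(n : ℝ)) * (3 / 4) ^ d / (H0 / ‖h‖)) * F h) := by gcongr
      _ = B * F h := by rw [hB]; field_simp
  -- classes
  have hcl : ∀ σ : Fin d → Bool, ∑ h ∈ s with (fun i => decide (0 ≤ h i)) = σ, F h ≤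
      (2 / (1 - exp (-(n : ℝ)))) ^ n := by
    intro σ
    apply class_sum hn _ y κ δ hκ0 hδ
    · rw [hκδ]
      have : 1 ≤ c ^ (2 * ((d : ℝ) / n)) := one_le_rpow hc1 (by positivity)
      nlinarith
    · intro h hh h' hh' hne
      rw [Finset.mem_filter, hs, Finset.mem_erase, Fintype.mem_piFinset] at hh hh'
      have hg : h - h' ≠ 0 := sub_ne_zero.2 hne
      have hN := hpos _ hg
      have hNH : ‖h - h'‖ ≤ H0 := by
        apply hlt
        intro i
        have h1 := hh.1.2 i
        have h2 := hh'.1.2 i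
        have h3 := congrFun (hh.2.trans hh'.2.symm) i
        simp only [decide_eq_decide] at h3
        rw [Finset.mem_Ioo] at h1 h2
        rw [Pi.sub_apply, abs_le]
        constructor <;> omega
      have h2 : (2 : ℕ) • (h - h') ≠ 0 := by
        intro h2
        have := hnorm2 (h - h')
        rw [h2, norm_zero] at this
        linarith
      obtain ⟨j, hj⟩ := hgap _ h2
      refine ⟨j, ?_⟩
      rw [hlin]
      refine le_trans ?_ hj
      rw [hnorm2, mul_div_mul_left _ _ (by norm_num : (2 : ℝ) ≠ 0)]
      have : 1 ≤ (H0 / ‖h - h'‖) ^ ((d : ℝ) / n) := by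
        apply one_le_rpow _ hpp
        rw [le_div_iff₀ hN]; linarith
      nlinarith
  have hsum : ∑ h ∈ s, F h ≤ 2 ^ d * (2 / (1 - exp (-(n : ℝ)))) ^ n := by
    rw [← Finset.sum_fiberwise s (fun h => (fun i => decide (0 ≤ h i)))]
    refine (Finset.sum_le_sum fun σ _ => hcl σ).trans (le_of_eq ?_)
    simp
  calc _ ≤ ∑ h ∈ s, B * F h := Finset.sum_le_sum hpt
    _ = B * ∑ h ∈ s, F h := by rw [Finset.mul_sum]
    _ ≤ B * (2 ^ d * (2 / (1 - exp (-(n : ℝ)))) ^ n) := by gcongr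
    _ = (1 / 2 * (2 ^ d * (3 / 4) ^ d) / H0) * (exp (-(n : ℝ)) * (2 / (1 - exp (-(n : ℝ)))) ^ n) := by
        rw [hB]; ring
    _ ≤ (1 / 2 * (2 ^ d * (3 / 4) ^ d) / H0) * 2 := by
        gcongr; exact const_bound n hn
    _ = _ := by
        rw [← mul_pow]; norm_num; ring


lemma cube_bound (d : ℕ) : (d : ℝ) ^ 3 ≤ 3 * (9 / 4) ^ d := by
  rcases Nat.lt_or_ge d 4 with h | h
  · interval_cases d <;> norm_num
  · induction d, h using Nat.le_induction with
    | base => norm_num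
    | succ m hm ih =>
      have hm' : (4 : ℝ) ≤ m := by exact_mod_cast hm
      rw [pow_succ (9 / 4 : ℝ) m]
      push_cast
      have : ((m : ℝ) + 1) ^ 3 ≤ 9 / 4 * (m : ℝ) ^ 3 := by nlinarith [mul_nonneg (sub_nonneg.2 hm') (sub_nonneg.2 hm')]
      linarith

lemma lin_bound (d : ℕ) : (d : ℝ) ≤ (9 / 4) ^ d := by
  have := one_add_mul_le_pow (a := (5 / 4 : ℝ)) (by norm_num) d
  have h : (1 + 5 / 4 : ℝ) = 9 / 4 := by norm_num
  rw [h] at this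
  have hd : (0 : ℝ) ≤ d := by positivity
  linarith

lemma tau_ok (d H : ℕ) (H0 δ : ℝ) (hH0 : 0 < H0) (hH : H0 ≤ H) (hδ : δ = 5 / 4 * √d / H0)
    (hδ2 : δ ≤ 0.145) : d * (1 - cos (π / (H + 1))) ≤ 1 / 4 * (1 - cos (2 * π * δ)) := by
  rcases Nat.eq_zero_or_pos d with hd | hd
  · subst hd; simp at hδ; simp [hδ]
  have hd' : (0 : ℝ) < d := by exact_mod_cast hd
  have hsd : 0 < √(d : ℝ) := Real.sqrt_pos.2 hd'
  have hδ0 : 0 < δ := by rw [hδ]; positivity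
  have h1 : 1 - cos (π / (H + 1)) ≤ (π / H0) ^ 2 / 2 := by
    have := one_sub_sq_div_two_le_cos (x := π / (H + 1))
    have h2 : (π / (H + 1)) ^ 2 ≤ (π / H0) ^ 2 := by gcongr; linarith
    linarith
  have h2 : 1 - cos (2 * π * δ) = 2 * sin (π * δ) ^ 2 := by
    rw [show 2 * π * δ = 2 * (π * δ) by ring, cos_two_mul, cos_sq']; ring
  have hx0 : 0 < π * δ := by positivity
  have hx1 : π * δ ≤ 0.46 := by nlinarith [pi_lt_d2, pi_pos]
  have h3 := sin_gt_sub_cube hx0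
  have h4 : 4 / 5 * (π * δ) ≤ sin (π * δ) := by nlinarith [mul_pos hx0 hx0]
  have h5 : 4 / 5 * (π * δ) = √d * (π / H0) := by rw [hδ]; field_simp
  have h6 : (√d * (π / H0)) ^ 2 ≤ sin (π * δ) ^ 2 := by
    rw [← h5]; exact pow_le_pow_left₀ (by positivity) h4 2
  rw [mul_pow, Real.sq_sqrt hd'.le] at h6
  have h7 : d * (1 - cos (π / (H + 1))) ≤ d * ((π / H0) ^ 2 / 2) := by gcongr
  rw [h2]; linarith

set_option maxHeartbeats 2000000

/-- Upper bound for badly approximable generators: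
D(Q^{*k}) ≤ (3/2)^d · 20 · (n/(C_A·√2))^(n/d) · k^(−n/(2d)). -/
theorem discrepancy_upper_bound (n d : ℕ) (hn : 0 < n) (hd : 0 < d)
    (A : Matrix (Fin n) (Fin d) ℝ) (C_A : ℝ) (hC : 0 < C_A)
    (hbad : ∀ h : Fin d → ℤ, h ≠ 0 →
      C_A / ‖h‖ ^ ((d : ℝ) / n) < supIntDist (A.mulVec (fun j => (h j : ℝ))))
    (k : ℕ) (hk : 1 ≤ k) :
    disc (convPow (genMeasure (fun j => A j)) k) ≤
      (3 / 2 : ℝ) ^ d * 20 * ((n : ℝ) / (C_A * Real.sqrt 2)) ^ ((n : ℝ) / d) *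
        (k : ℝ) ^ (-(n : ℝ) / (2 * d)) := by
  have hn' : (0 : ℝ) < n := by exact_mod_cast hn
  have hd' : (0 : ℝ) < d := by exact_mod_cast hd
  have hk' : (0 : ℝ) < k := by exact_mod_cast hk
  have hpg := prob_gen hn (fun j => A j)
  have hpk := prob_pow (genMeasure (fun j => A j)) k
  set X : ℝ := ((n : ℝ) / (C_A * Real.sqrt 2)) ^ ((n : ℝ) / d) * (k : ℝ) ^ (-(n : ℝ) / (2 * d)) with hX
  have hX0 : 0 < X := by positivity
  rw [mul_assoc, ← hX]
  set w : ℝ := (3 / 2 : ℝ) ^ d with hw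
  have hw0 : 0 < w := by positivity
  have hw1 : 1 ≤ w := one_le_pow₀ (by norm_num)
  by_cases hbig : 1 ≤ w * 20 * X
  · exact (disc_le _ 1 (by norm_num) (fun a b => err_le_one _ a b)).trans hbig
  push Not at hbig
  set c : ℝ := 2 / √3 with hc
  have hc0 : 0 < c := by positivity
  have hc2 : c ^ 2 = 4 / 3 := by rw [hc, div_pow, Real.sq_sqrt (by norm_num)]; norm_num
  have hc1 : 1 ≤ c := by nlinarith
  have hcu : c ≤ 1.1548 := by nlinarith
  set H0 : ℝ := 1 / (2 * (c * X)) with hH0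
  have hH00 : 0 < H0 := by positivity
  have hH0i : 1 / H0 = 2 * (c * X) := by rw [hH0, one_div_one_div]
  have h2H0 : 2 * H0 = (c * X)⁻¹ := by rw [hH0]; field_simp
  have hcX : 2 * (c * X) ≤ 2.3096 * X := by nlinarith
  have hXs : w * X < 1 / 20 := by linarith
  have hXs' : X < 1 / 20 := by nlinarith
  set p : ℝ := (d : ℝ) / n with hp
  set δ : ℝ := C_A * (c * X) ^ p with hδ
  have hδ0 : 0 < δ := by positivity
  have hXp : X ^ p = (n / (C_A * √2)) * (k : ℝ) ^ (-(1 / 2) : ℝ) := by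
    rw [hX, mul_rpow (by positivity) (by positivity), ← rpow_mul (by positivity), ← rpow_mul (by positivity)]
    have e1 : (n : ℝ) / d * p = 1 := by rw [hp]; field_simp
    have e2 : -(n : ℝ) / (2 * d) * p = -(1 / 2) := by rw [hp]; field_simp
    rw [e1, e2, rpow_one]
  have hk2 : ((k : ℝ) ^ (-(1 / 2) : ℝ)) ^ 2 = (k : ℝ)⁻¹ := by
    rw [← rpow_natCast, ← rpow_mul hk'.le, ← rpow_neg_one]
    norm_num
  have hκδ : (2 * k / n : ℝ) * δ ^ 2 = n * c ^ (2 * ((d : ℝ) / n)) := by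
    rw [← hp, hδ, mul_rpow hc0.le hX0.le, hXp, mul_comm 2 p, rpow_mul hc0.le, rpow_ofNat]
    have s2 : √(2 : ℝ) ^ 2 = 2 := Real.sq_sqrt (by norm_num)
    calc _ = (2 * k / n : ℝ) * (C_A ^ 2 * (c ^ p) ^ 2 * (n ^ 2 / (C_A ^ 2 * √2 ^ 2)) *
          ((k : ℝ) ^ (-(1 / 2) : ℝ)) ^ 2) := by ring
      _ = _ := by rw [hk2, s2]; field_simp
  have hne : Nonempty (Fin n) := ⟨⟨0, hn⟩⟩
  have hgap : ∀ g : Fin d → ℤ, g ≠ 0 → ∃ j, δ * (2 * H0 / ‖g‖) ^ ((d : ℝ) / n) ≤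
      intDist (A.mulVec (fun i => (g i : ℝ)) j) := by
    intro g hg
    obtain ⟨j, hj⟩ := exists_lt_of_lt_ciSup (hbad g hg)
    refine ⟨j, le_trans (le_of_eq ?_) hj.le⟩
    have hg0 : 0 < ‖g‖ := norm_pos_iff.2 hg
    rw [← hp, h2H0, hδ, div_rpow (by positivity) hg0.le, inv_rpow (by positivity)]
    have : 0 < (c * X) ^ p := by positivity
    field_simp
  set H : ℕ := ⌈H0⌉₊ with hH
  have hHlo : H0 ≤ H := Nat.le_ceil _
  have hHhi : (H : ℝ) < H0 + 1 := Nat.ceil_lt_add_one hH00.le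
  have hH2 : 2 ≤ H := by
    have : (2 : ℝ) ≤ H0 := by
      rw [hH0, le_div_iff₀ (by positivity)]; linarith
    have : (2 : ℝ) ≤ H := this.trans hHlo
    exact_mod_cast this
  have hww : w ^ 2 = (9 / 4) ^ d := by
    rw [hw, ← pow_mul, mul_comm, pow_mul]; norm_num
  have hsd : 0 ≤ √(d : ℝ) := Real.sqrt_nonneg _
  have hsd2 : √(d : ℝ) ^ 2 = d := Real.sq_sqrt hd'.le
  have hsw : √(d : ℝ) ≤ w := by
    apply Real.sqrt_le_iff.2 ⟨hw0.le, ?_⟩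
    rw [hww]; exact lin_bound d
  have hdsw : d * √(d : ℝ) ≤ 1.7321 * w := by
    refine (sq_le_sq₀ (by positivity) (by positivity)).1 ?_
    have := cube_bound d
    rw [← hww] at this
    calc (d * √(d : ℝ)) ^ 2 = (d : ℝ) ^ 3 := by rw [mul_pow, hsd2]; ring
      _ ≤ 3 * w ^ 2 := this
      _ ≤ (1.7321 * w) ^ 2 := by nlinarith [sq_nonneg w]
  set η : ℝ := 5 / 4 * √d / H0 with hη
  have hη' : η = 5 / 4 * √d * (2 * (c * X)) := by rw [hη, ← hH0i]; ring
  have hη0 : 0 < η := by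
    have : 0 < √(d : ℝ) := Real.sqrt_pos.2 hd'
    positivity
  have hη2 : η ≤ 0.145 := by
    rw [hη']
    calc _ ≤ 5 / 4 * w * (2.3096 * X) := by gcongr
      _ = 2.887 * (w * X) := by ring
      _ ≤ _ := by linarith
  have hmain := smoothing (convPow (genMeasure (fun j => A j)) k) H hH2 η hη0 (by linarith)
    (tau_ok d H H0 η hH00 hHlo hη hη2) (w / H0)
    (fun a b => E_bound n d hn hd A k δ H0 c H hδ0 hH00 hHhi hc1 hc2 hκδ hgap a b)
  refine hmain.trans ?_
  calc 3 * d * η + 2 * (w / H0) = (15 / 4 * (d * √d) + 2 * w) * (2 * (c * X)) := by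
        rw [hη, ← hH0i]; ring
    _ ≤ (15 / 4 * (1.7321 * w) + 2 * w) * (2.3096 * X) := by gcongr
    _ ≤ w * 20 * X := by nlinarith [mul_pos hw0 hX0]
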